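/- Let X = (ℝⁿ, ‖·‖) be a normed space whose unit ball B_X is in John's position, and for m ≥ 1 define the norm ‖(x; z)‖_Y = max{ ‖x‖, ‖z‖₂ } on ℝⁿ × ℝᵐ = ℝ^{n+m}. Then: (i) the unit ball B_Y of Y = (ℝ^{n+m}, ‖·‖_Y) is in John's position; and (ii) there exist absolute constants C, c > 0 such that if m ≥ C·k(X), then Var(‖G‖_Y) ≥ c·b(Y)², where G ~ N(0, I_{n+m}). -/

import Mathlib

open MeasureTheory ProbabilityTheory Real

/-- The standard Gaussian measure `γ_d` on `ℝᵈ`. -/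
noncomputable def stdGaussian (d : ℕ) : Measure (Fin d → ℝ) :=
  Measure.pi fun _ => gaussianReal 0 1

/-- The Euclidean norm on `ℝᵈ`. -/
noncomputable def euclNorm {d : ℕ} (x : Fin d → ℝ) : ℝ :=
  Real.sqrt (∑ i, (x i) ^ 2)

/-- `b(X) = max{ N θ : ‖θ‖₂ = 1 }`, the Lipschitz constant of the norm `N`. -/
noncomputable def bConst {d : ℕ} (N : (Fin d → ℝ) → ℝ) : ℝ :=
  sSup {s | ∃ θ : Fin d → ℝ, euclNorm θ = 1 ∧ s = N θ}

/-- The critical dimension (Dvoretzky number) `k(X) = (E N(G) / b(X))²`. -/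
noncomputable def critDim (d : ℕ) (N : (Fin d → ℝ) → ℝ) : ℝ :=
  ((∫ x, N x ∂stdGaussian d) / bConst N) ^ 2

/-- The unit ball of `N` is in John's position: the Euclidean unit ball is contained in
it, and any affine image of the Euclidean unit ball contained in it has volume at most
that of the Euclidean unit ball. -/
def JohnPosition {d : ℕ} (N : (Fin d → ℝ) → ℝ) : Prop :=
  (∀ x, euclNorm x ≤ 1 → N x ≤ 1) ∧
  ∀ (T : (Fin d → ℝ) →ₗ[ℝ] (Fin d → ℝ)) (v : Fin d → ℝ),
    (∀ x, euclNorm x ≤ 1 → N (T x + v) ≤ 1) →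
    MeasureTheory.volume ((fun x => T x + v) '' {x | euclNorm x ≤ 1})
      ≤ MeasureTheory.volume {x : Fin d → ℝ | euclNorm x ≤ 1}

/-- The norm `‖(x;z)‖_Y = max{N(x), ‖z‖₂}` of `Y = (X ⊕ ℓ₂ᵐ)_∞` on `ℝ^{n+m}`. -/
noncomputable def normY (n m : ℕ) (N : (Fin n → ℝ) → ℝ) (y : Fin (n + m) → ℝ) : ℝ :=
  max (N fun i => y (Fin.castAdd m i)) (euclNorm fun j : Fin m => y (Fin.natAdd n j))

lemma euclNorm_eq_norm {d : ℕ} (x : Fin d → ℝ) : euclNorm x = ‖WithLp.toLp 2 x‖ := by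
  simp [euclNorm, EuclideanSpace.norm_eq]

lemma euclNorm_sq {d : ℕ} (x : Fin d → ℝ) : euclNorm x ^ 2 = ∑ i, x i ^ 2 :=
  Real.sq_sqrt (Finset.sum_nonneg fun i _ => sq_nonneg (x i))

lemma euclNorm_nonneg {d : ℕ} (x : Fin d → ℝ) : 0 ≤ euclNorm x := Real.sqrt_nonneg _

lemma continuous_euclNorm {d : ℕ} : Continuous (euclNorm : (Fin d → ℝ) → ℝ) := by
  unfold euclNorm; fun_prop

lemma euclNorm_smul {d : ℕ} (r : ℝ) (x : Fin d → ℝ) : euclNorm (r • x) = |r| * euclNorm x := by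
  simp [euclNorm_eq_norm, norm_smul]

lemma euclNorm_eq_zero {d : ℕ} {x : Fin d → ℝ} (h : euclNorm x = 0) : x = 0 := by
  simpa [euclNorm_eq_norm] using h

lemma euclNorm_split_sq {n m : ℕ} (y : Fin (n + m) → ℝ) :
    euclNorm y ^ 2 = euclNorm (fun i => y (Fin.castAdd m i)) ^ 2
      + euclNorm (fun j => y (Fin.natAdd n j)) ^ 2 := by
  simp only [euclNorm_sq, Fin.sum_univ_add]

lemma euclNorm_castAdd_le {n m : ℕ} (y : Fin (n + m) → ℝ) :
    euclNorm (fun i => y (Fin.castAdd m i)) ≤ euclNorm y :=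
  Real.sqrt_le_sqrt (by
    rw [Fin.sum_univ_add]
    exact le_add_of_nonneg_right (Finset.sum_nonneg fun i _ => sq_nonneg _))

lemma euclNorm_natAdd_le {n m : ℕ} (y : Fin (n + m) → ℝ) :
    euclNorm (fun j => y (Fin.natAdd n j)) ≤ euclNorm y :=
  Real.sqrt_le_sqrt (by
    rw [Fin.sum_univ_add]
    exact le_add_of_nonneg_left (Finset.sum_nonneg fun i _ => sq_nonneg _))

lemma volume_euclBall_ne_zero (d : ℕ) :
    volume {x : Fin d → ℝ | euclNorm x ≤ 1} ≠ 0 := by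
  have ho : IsOpen {x : Fin d → ℝ | euclNorm x < 1} :=
    isOpen_lt continuous_euclNorm continuous_const
  have := ho.measure_pos volume ⟨0, by simp [euclNorm]⟩
  exact (this.trans_le (measure_mono (Set.ofPred_subset_ofPred.2 fun _ hx => hx.le))).ne'

lemma volume_euclBall_ne_top (d : ℕ) :
    volume {x : Fin d → ℝ | euclNorm x ≤ 1} ≠ ⊤ := by
  have : {x : Fin d → ℝ | euclNorm x ≤ 1} ⊆ Metric.closedBall 0 1 := by
    intro x hx
    rw [mem_closedBall_zero_iff, pi_norm_le_iff_of_nonneg zero_le_one]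
    intro i
    have h := PiLp.norm_apply_le (WithLp.toLp 2 x) i
    rw [← euclNorm_eq_norm] at h
    exact h.trans hx
  exact ((measure_mono this).trans_lt measure_closedBall_lt_top).ne

lemma volume_affine_image {d : ℕ} (T : (Fin d → ℝ) →ₗ[ℝ] (Fin d → ℝ)) (v : Fin d → ℝ)
    (s : Set (Fin d → ℝ)) :
    volume ((fun x => T x + v) '' s) = ENNReal.ofReal |LinearMap.det T| * volume s := by
  have : (fun x => T x + v) '' s = (fun x => x + v) '' (T '' s) := by
    rw [Set.image_image]
  rw [this, Set.image_add_right, measure_preimage_add_right, Measure.addHaar_image_linearMap]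

lemma volume_affine_image_le_iff {d : ℕ} (T : (Fin d → ℝ) →ₗ[ℝ] (Fin d → ℝ)) (v : Fin d → ℝ) :
    volume ((fun x => T x + v) '' {x | euclNorm x ≤ 1}) ≤ volume {x : Fin d → ℝ | euclNorm x ≤ 1}
      ↔ |LinearMap.det T| ≤ 1 := by
  rw [volume_affine_image, ← ENNReal.le_div_iff_mul_le (.inl (volume_euclBall_ne_zero d))
    (.inl (volume_euclBall_ne_top d)),
    ENNReal.div_self (volume_euclBall_ne_zero d) (volume_euclBall_ne_top d), ENNReal.ofReal_le_one]

/-- The Euclidean unit ball is in John's position. -/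
lemma abs_det_le_one_of_mapsTo_ball {d : ℕ} (T : (Fin d → ℝ) →ₗ[ℝ] (Fin d → ℝ)) (v : Fin d → ℝ)
    (h : ∀ x, euclNorm x ≤ 1 → euclNorm (T x + v) ≤ 1) : |LinearMap.det T| ≤ 1 := by
  rw [← volume_affine_image_le_iff T v]
  exact measure_mono (Set.image_subset_iff.2 h)

/-- Inclusion of the first coordinates. -/
def inclLeft (n m : ℕ) : (Fin n → ℝ) →ₗ[ℝ] (Fin (n + m) → ℝ) where
  toFun x := Fin.append x 0
  map_add' x y := by
    ext i; refine Fin.addCases (fun i => ?_) (fun i => ?_) i <;> simp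
  map_smul' r x := by
    ext i; refine Fin.addCases (fun i => ?_) (fun i => ?_) i <;> simp

/-- Inclusion of the last coordinates. -/
def inclRight (n m : ℕ) : (Fin m → ℝ) →ₗ[ℝ] (Fin (n + m) → ℝ) where
  toFun z := Fin.append 0 z
  map_add' x y := by
    ext i; refine Fin.addCases (fun i => ?_) (fun i => ?_) i <;> simp
  map_smul' r x := by
    ext i; refine Fin.addCases (fun i => ?_) (fun i => ?_) i <;> simp

/-- Projection onto the first coordinates. -/
abbrev projLeft (n m : ℕ) : (Fin (n + m) → ℝ) →ₗ[ℝ] (Fin n → ℝ) :=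
  LinearMap.funLeft ℝ ℝ (Fin.castAdd m)

/-- Projection onto the last coordinates. -/
abbrev projRight (n m : ℕ) : (Fin (n + m) → ℝ) →ₗ[ℝ] (Fin m → ℝ) :=
  LinearMap.funLeft ℝ ℝ (Fin.natAdd n)

lemma euclNorm_inclLeft {n m : ℕ} (x : Fin n → ℝ) : euclNorm (inclLeft n m x) = euclNorm x := by
  simp [euclNorm, inclLeft, Fin.sum_univ_add]

lemma euclNorm_inclRight {n m : ℕ} (x : Fin m → ℝ) : euclNorm (inclRight n m x) = euclNorm x := by
  simp [euclNorm, inclRight, Fin.sum_univ_add]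

lemma det_eq_mul_of_lower_triangular {n m : ℕ} (L : (Fin (n + m) → ℝ) →ₗ[ℝ] (Fin (n + m) → ℝ))
    (h : ∀ z, projLeft n m (L (inclRight n m z)) = 0) :
    LinearMap.det L = LinearMap.det (projLeft n m ∘ₗ L ∘ₗ inclLeft n m) *
      LinearMap.det (projRight n m ∘ₗ L ∘ₗ inclRight n m) := by
  have hl (j : Fin n) : (Pi.single (Fin.castAdd m j) 1 : Fin (n + m) → ℝ)
      = inclLeft n m (Pi.single j 1) := by
    ext i; refine Fin.addCases (fun i => ?_) (fun i => ?_) i <;>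
      simp [inclLeft, Pi.single_apply, Fin.ext_iff]
    omega
  have hr (j : Fin m) : (Pi.single (Fin.natAdd n j) 1 : Fin (n + m) → ℝ)
      = inclRight n m (Pi.single j 1) := by
    ext i; refine Fin.addCases (fun i => ?_) (fun i => ?_) i <;>
      simp [inclRight, Pi.single_apply, Fin.ext_iff]
    omega
  rw [← LinearMap.det_toMatrix', ← LinearMap.det_toMatrix', ← LinearMap.det_toMatrix',
    ← Matrix.det_submatrix_equiv_self (finSumFinEquiv (m := n) (n := m)),
    ← Matrix.det_fromBlocks_zero₁₂ _
      (LinearMap.toMatrix' (projRight n m ∘ₗ L ∘ₗ inclLeft n m)) _]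
  congr 1
  ext i j
  rcases i with i | i <;> rcases j with j | j
  · simp [LinearMap.toMatrix'_apply, hl, LinearMap.funLeft]
  · have := congrFun (h (Pi.single j 1)) i
    simpa [LinearMap.toMatrix'_apply, hr, LinearMap.funLeft] using this
  · simp [LinearMap.toMatrix'_apply, hl, LinearMap.funLeft]
  · simp [LinearMap.toMatrix'_apply, hr, LinearMap.funLeft]

/-- A linear surjection becomes the projection followed by an isomorphism in suitable orthonormal
coordinates: its kernel can be rotated onto the last coordinates. -/
lemma exists_rotation_ker {n m : ℕ} (A : (Fin (n + m) → ℝ) →ₗ[ℝ] (Fin n → ℝ))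
    (hA : Function.Surjective A) :
    ∃ U : (Fin (n + m) → ℝ) →ₗ[ℝ] (Fin (n + m) → ℝ),
      (∀ x, euclNorm (U x) = euclNorm x) ∧ ∀ z, A (U (inclRight n m z)) = 0 := by
  let e := WithLp.linearEquiv 2 ℝ (Fin (n + m) → ℝ)
  let A' : EuclideanSpace ℝ (Fin (n + m)) →ₗ[ℝ] (Fin n → ℝ) := A ∘ₗ e.toLinearMap
  have hA' : Function.Surjective A' := hA.comp e.surjective
  let K := LinearMap.ker A'
  have h1 := LinearMap.finrank_range_add_finrank_ker A'
  rw [LinearMap.range_eq_top.2 hA', finrank_top] at h1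
  have hK : Module.finrank ℝ K = m := by simp at h1; exact h1
  have h2 := K.finrank_add_finrank_orthogonal
  have hK' : Module.finrank ℝ Kᗮ = n := by
    simp [hK] at h2; omega
  let b := (stdOrthonormalBasis ℝ K).reindex (finCongr hK)
  let b' := (stdOrthonormalBasis ℝ Kᗮ).reindex (finCongr hK')
  let V : (Fin (n + m) → ℝ) →ₗ[ℝ] EuclideanSpace ℝ (Fin (n + m)) :=
    Kᗮ.subtype ∘ₗ b'.repr.symm.toLinearEquiv.toLinearMap ∘ₗ
      (WithLp.linearEquiv 2 ℝ (Fin n → ℝ)).symm.toLinearMap ∘ₗ projLeft n m +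
    K.subtype ∘ₗ b.repr.symm.toLinearEquiv.toLinearMap ∘ₗ
      (WithLp.linearEquiv 2 ℝ (Fin m → ℝ)).symm.toLinearMap ∘ₗ projRight n m
  have hV (x) : V x = (b'.repr.symm (WithLp.toLp 2 (projLeft n m x)) : Kᗮ)
      + ((b.repr.symm (WithLp.toLp 2 (projRight n m x)) : K) : EuclideanSpace ℝ (Fin (n + m))) :=
    rfl
  refine ⟨e.toLinearMap ∘ₗ V, fun x => ?_, fun z => ?_⟩
  · have hx : euclNorm ((e.toLinearMap ∘ₗ V) x) = ‖V x‖ := euclNorm_eq_norm _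
    rw [hx, ← sq_eq_sq₀ (norm_nonneg _) (euclNorm_nonneg _), euclNorm_split_sq, hV, sq,
      norm_add_sq_eq_norm_sq_add_norm_sq_of_inner_eq_zero (𝕜 := ℝ)]
    · rw [← Submodule.coe_norm, ← Submodule.coe_norm, LinearIsometryEquiv.norm_map,
        LinearIsometryEquiv.norm_map, ← euclNorm_eq_norm, ← euclNorm_eq_norm, ← sq, ← sq]
      rfl
    · exact Submodule.inner_left_of_mem_orthogonal (Subtype.coe_prop _) (Subtype.coe_prop _)
  · have h0 : projLeft n m (inclRight n m z) = 0 := by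
      ext i; simp [inclRight, LinearMap.funLeft]
    have : V (inclRight n m z) ∈ K := by
      rw [hV, h0]; simp
    exact this

lemma image_euclBall_of_isometry {d : ℕ} (U : (Fin d → ℝ) →ₗ[ℝ] (Fin d → ℝ))
    (hU : ∀ x, euclNorm (U x) = euclNorm x) :
    U '' {x | euclNorm x ≤ 1} = {x | euclNorm x ≤ 1} := by
  have hinj : Function.Injective U := by
    rw [← LinearMap.ker_eq_bot, LinearMap.ker_eq_bot']
    intro x hx
    exact euclNorm_eq_zero (by rw [← hU, hx]; simp [euclNorm])
  have hsurj := LinearMap.injective_iff_surjective.1 hinj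
  ext y
  constructor
  · rintro ⟨x, hx, rfl⟩
    exact (hU x).trans_le hx
  · intro hy
    obtain ⟨x, rfl⟩ := hsurj y
    exact ⟨x, (hU x).symm.trans_le hy, rfl⟩

theorem johnPosition_normY {n m : ℕ} {N : (Fin n → ℝ) → ℝ} (hN : ∀ x, N x ≤ euclNorm x)
    (hJ : JohnPosition N) : JohnPosition (normY n m N) := by
  refine ⟨fun y hy => ?_, fun T v hT => ?_⟩
  · exact max_le ((hN _).trans ((euclNorm_castAdd_le y).trans hy))
      ((euclNorm_natAdd_le y).trans hy)
  rw [volume_affine_image_le_iff]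
  by_cases hdet : LinearMap.det T = 0
  · simp [hdet]
  have hsurj : Function.Surjective T :=
    (LinearMap.equivOfDetNeZero T hdet).surjective
  have hpsurj : Function.Surjective (projLeft n m) :=
    LinearMap.funLeft_surjective_of_injective _ _ _ (Fin.castAdd_injective n m)
  obtain ⟨U, hU, hker⟩ := exists_rotation_ker (projLeft n m ∘ₗ T) (hpsurj.comp hsurj)
  have hdetU : |LinearMap.det U| = 1 := by
    have h := Measure.addHaar_image_linearMap volume U {x | euclNorm x ≤ 1}
    rw [image_euclBall_of_isometry U hU] at h
    have := (ENNReal.mul_eq_right (volume_euclBall_ne_zero _) (volume_euclBall_ne_top _)).1 h.symm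
    simpa using this
  have hball : ∀ y, euclNorm y ≤ 1 → normY n m N ((T ∘ₗ U) y + v) ≤ 1 := fun y hy =>
    hT (U y) ((hU y).trans_le hy)
  have hP : |LinearMap.det (projLeft n m ∘ₗ (T ∘ₗ U) ∘ₗ inclLeft n m)| ≤ 1 := by
    rw [← volume_affine_image_le_iff _ (projLeft n m v)]
    exact hJ.2 _ _ fun x hx =>
      (le_max_left _ _).trans (hball (inclLeft n m x) ((euclNorm_inclLeft x).trans_le hx))
  have hR : |LinearMap.det (projRight n m ∘ₗ (T ∘ₗ U) ∘ₗ inclRight n m)| ≤ 1 :=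
    abs_det_le_one_of_mapsTo_ball _ (projRight n m v) fun x hx =>
      (le_max_right _ _).trans (hball (inclRight n m x) ((euclNorm_inclRight x).trans_le hx))
  have := det_eq_mul_of_lower_triangular (T ∘ₗ U) hker
  rw [LinearMap.det_comp] at this
  calc |LinearMap.det T| = |LinearMap.det T * LinearMap.det U| := by rw [abs_mul, hdetU, mul_one]
    _ ≤ 1 := by rw [this, abs_mul]; exact mul_le_one₀ hP (abs_nonneg _) hR

/-- The density of the law of `t * g` with respect to the law of `g`, for `g` standard Gaussian. -/
noncomputable def scalingDensity (t x : ℝ) : ℝ := t⁻¹ * exp (-(t⁻¹ ^ 2 - 1) * x ^ 2 / 2)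

lemma scalingDensity_one (x : ℝ) : scalingDensity 1 x = 1 := by simp [scalingDensity]

lemma continuous_scalingDensity (t : ℝ) : Continuous (scalingDensity t) := by
  unfold scalingDensity; fun_prop

lemma scalingDensity_nonneg {t : ℝ} (ht : 0 < t) (x : ℝ) : 0 ≤ scalingDensity t x := by
  unfold scalingDensity; positivity

lemma scalingDensity_le {t : ℝ} (ht : 0 < t) (ht1 : t ≤ 1) (x : ℝ) :
    scalingDensity t x ≤ t⁻¹ := by
  have h1 : 1 ≤ t⁻¹ ^ 2 := one_le_pow₀ ((one_le_inv₀ ht).2 ht1)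
  refine mul_le_of_le_one_right (by positivity) (exp_le_one_iff.2 ?_)
  have := mul_nonneg (sub_nonneg.2 h1) (sq_nonneg x)
  linarith

lemma gaussianReal_map_mul_eq_withDensity {t : ℝ} (ht : 0 < t) :
    (gaussianReal 0 1).map (t * ·)
      = (gaussianReal 0 1).withDensity fun x => ENNReal.ofReal (scalingDensity t x) := by
  rw [gaussianReal_map_const_mul, gaussianReal_of_var_ne_zero, gaussianReal_of_var_ne_zero,
    ← withDensity_mul _ (measurable_gaussianPDF _ _)
      (continuous_scalingDensity t).measurable.ennreal_ofReal]
  · congr 1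
    ext x
    rw [Pi.mul_apply, gaussianPDF, gaussianPDF, ← ENNReal.ofReal_mul (gaussianPDFReal_nonneg _ _ _)]
    congr 1
    have hs : √(2 * π * (t ^ 2)) = √(2 * π) * t := by
      rw [Real.sqrt_mul (by positivity), Real.sqrt_sq ht.le]
    simp only [gaussianPDFReal, scalingDensity, mul_zero, mul_one, NNReal.coe_one, NNReal.coe_mk,
      sub_zero]
    rw [hs, mul_mul_mul_comm, ← exp_add, mul_inv]
    congr 2
    field_simp
    ring
  · exact one_ne_zero
  · rw [mul_one, ne_eq, ← NNReal.coe_inj]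
    simp [ht.ne']

lemma integral_scalingDensity_sq {t : ℝ} (ht : 0 < t) (ht1 : t ≤ 1) :
    ∫ x, scalingDensity t x ^ 2 ∂gaussianReal 0 1 = (√(t ^ 2 * (2 - t ^ 2)))⁻¹ := by
  rw [integral_gaussianReal_eq_integral_smul one_ne_zero]
  have h (x : ℝ) : gaussianPDFReal 0 1 x • scalingDensity t x ^ 2
      = ((√(2 * π))⁻¹ * t⁻¹ ^ 2) * exp (-(t⁻¹ ^ 2 - 1 / 2) * x ^ 2) := by
    simp only [gaussianPDFReal, scalingDensity, NNReal.coe_one, mul_one, sub_zero, smul_eq_mul,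
      mul_pow, ← exp_nat_mul]
    rw [mul_mul_mul_comm, ← exp_add]
    congr 2
    push_cast
    ring
  simp_rw [h]
  have h2 : 0 < 2 - t ^ 2 := by nlinarith
  rw [integral_const_mul, integral_gaussian, ← Real.sqrt_inv]
  have h3 : t⁻¹ ^ 2 - 1 / 2 = (2 - t ^ 2) / (2 * t ^ 2) := by field_simp
  rw [h3, ← Real.sqrt_sq (show (0 : ℝ) ≤ t⁻¹ ^ 2 by positivity), ← Real.sqrt_mul (by positivity),
    ← Real.sqrt_mul (by positivity), ← Real.sqrt_inv]
  congr 1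
  field_simp

lemma pi_withDensity_ofReal {ι : Type*} [Fintype ι] (μ : ι → Measure ℝ)
    [∀ i, IsProbabilityMeasure (μ i)] (ρ : ι → ℝ → ℝ) (hρ0 : ∀ i x, 0 ≤ ρ i x)
    (hρ : ∀ i, Integrable (ρ i) (μ i))
    [∀ i, SigmaFinite ((μ i).withDensity fun x => ENNReal.ofReal (ρ i x))] :
    Measure.pi (fun i => (μ i).withDensity fun x => ENNReal.ofReal (ρ i x))
      = (Measure.pi μ).withDensity fun y => ENNReal.ofReal (∏ i, ρ i (y i)) := by
  refine Measure.pi_eq fun s hs => ?_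
  have hI (i) : Integrable ((s i).indicator (ρ i)) (μ i) := (hρ i).indicator (hs i)
  have hprod : (Set.univ.pi s).indicator (fun y : ι → ℝ => ∏ i, ρ i (y i))
      = fun y => ∏ i, (s i).indicator (ρ i) (y i) := by
    ext y
    by_cases hy : y ∈ Set.univ.pi s
    · rw [Set.indicator_of_mem hy]
      exact Finset.prod_congr rfl fun i _ => by rw [Set.indicator_of_mem (hy i trivial)]
    · rw [Set.indicator_of_notMem hy]
      simp only [Set.mem_pi, Set.mem_univ, true_implies, not_forall] at hy
      obtain ⟨i, hi⟩ := hy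
      exact (Finset.prod_eq_zero (Finset.mem_univ i) (Set.indicator_of_notMem hi _)).symm
  have hIp := Integrable.fintype_prod_dep (μ := μ) hI
  have hnn (i) (x) : 0 ≤ (s i).indicator (ρ i) x := Set.indicator_nonneg (fun x _ => hρ0 i x) x
  rw [withDensity_apply _ (MeasurableSet.univ_pi hs)]
  have hset (i) : ((μ i).withDensity fun x => ENNReal.ofReal (ρ i x)) (s i)
      = ENNReal.ofReal (∫ x, (s i).indicator (ρ i) x ∂μ i) := by
    rw [withDensity_apply _ (hs i), integral_indicator (hs i),
      ofReal_integral_eq_lintegral_ofReal (hρ i).integrableOn (ae_of_all _ (hρ0 i))]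
  simp_rw [hset]
  rw [← ENNReal.ofReal_prod_of_nonneg fun i _ => integral_nonneg (hnn i),
    ← integral_fintype_prod_eq_prod (μ := μ) (fun i => (s i).indicator (ρ i)), ← hprod,
    integral_indicator (MeasurableSet.univ_pi hs), ofReal_integral_eq_lintegral_ofReal]
  · rw [← hprod] at hIp
    exact (integrable_indicator_iff (MeasurableSet.univ_pi hs)).1 hIp
  · exact ae_of_all _ fun y => Finset.prod_nonneg fun i _ => hρ0 i _

instance (d : ℕ) : IsProbabilityMeasure (stdGaussian d) := by unfold _root_.stdGaussian; infer_instance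

lemma stdGaussian_map_scaling {d : ℕ} (s : Fin d → ℝ) (hs : ∀ i, 0 < s i) (hs1 : ∀ i, s i ≤ 1) :
    (stdGaussian d).map (fun y i => s i * y i) = (stdGaussian d).withDensity
      fun y => ENNReal.ofReal (∏ i, scalingDensity (s i) (y i)) := by
  have hp (i) : IsProbabilityMeasure ((gaussianReal 0 1).map (s i * ·)) :=
    Measure.isProbabilityMeasure_map (by fun_prop)
  have hp' (i) : IsProbabilityMeasure ((gaussianReal 0 1).withDensity
      fun x => ENNReal.ofReal (scalingDensity (s i) x)) := by
    rw [← gaussianReal_map_mul_eq_withDensity (hs i)]; exact hp i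
  unfold _root_.stdGaussian
  rw [Measure.pi_map_pi (f := fun i x => s i * x) (fun i => by fun_prop),
    ← pi_withDensity_ofReal _ _ (fun i => scalingDensity_nonneg (hs i)) _]
  · simp_rw [fun i => gaussianReal_map_mul_eq_withDensity (hs i)]
  · intro i
    refine .of_bound (continuous_scalingDensity _).aestronglyMeasurable (s i)⁻¹
      (ae_of_all _ fun x => ?_)
    rw [Real.norm_of_nonneg (scalingDensity_nonneg (hs i) x)]
    exact scalingDensity_le (hs i) (hs1 i) x

lemma integral_comp_scaling {d : ℕ} (s : Fin d → ℝ) (hs : ∀ i, 0 < s i) (hs1 : ∀ i, s i ≤ 1)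
    {F : (Fin d → ℝ) → ℝ} (hF : Continuous F) :
    ∫ y, F (fun i => s i * y i) ∂stdGaussian d
      = ∫ y, (∏ i, scalingDensity (s i) (y i)) * F y ∂stdGaussian d := by
  have hmap := integral_map (μ := _root_.stdGaussian d) (φ := fun y i => s i * y i) (f := F)
    (by fun_prop : Measurable _).aemeasurable hF.aestronglyMeasurable
  rw [← hmap, stdGaussian_map_scaling s hs hs1, integral_withDensity_eq_integral_toReal_smul]
  · refine integral_congr_ae (ae_of_all _ fun y => ?_)
    simp only [smul_eq_mul]
    rw [ENNReal.toReal_ofReal (Finset.prod_nonneg fun i _ => scalingDensity_nonneg (hs i) _)]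
  · refine Measurable.ennreal_ofReal (Continuous.measurable ?_)
    exact continuous_finsetProd _ fun i _ => (continuous_scalingDensity _).comp (continuous_apply i)
  · exact ae_of_all _ fun y => ENNReal.ofReal_lt_top

/-- A covariance bound for the variance: the Cauchy-Schwarz inequality against a density `h`. -/
lemma sq_integral_sub_le_variance {Ω : Type*} [MeasurableSpace Ω] {μ : Measure Ω}
    [IsProbabilityMeasure μ] {F h : Ω → ℝ} (hF : MemLp F 2 μ) (hh : MemLp h 2 μ)
    (h1 : ∫ x, h x ∂μ = 1) (h2 : ∫ x, h x ^ 2 ∂μ ≤ 2) :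
    (∫ x, F x ∂μ - ∫ x, h x * F x ∂μ) ^ 2 ≤ ∫ x, F x ^ 2 ∂μ - (∫ x, F x ∂μ) ^ 2 := by
  have hF1 : Integrable F μ := hF.integrable one_le_two
  have hh1 : Integrable h μ := hh.integrable one_le_two
  have hF2 := hF.integrable_sq
  have hh2 := hh.integrable_sq
  have hhF : Integrable (fun x => h x * F x) μ := hh.integrable_mul hF
  have key (c d : ℝ) : ∫ x, (F x - c * h x + d) ^ 2 ∂μ
      = ∫ x, F x ^ 2 ∂μ + c ^ 2 * ∫ x, h x ^ 2 ∂μ + d ^ 2 - 2 * c * ∫ x, h x * F x ∂μ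
        + 2 * d * ∫ x, F x ∂μ - 2 * c * d * ∫ x, h x ∂μ := by
    have e (x) : (F x - c * h x + d) ^ 2 = F x ^ 2 + c ^ 2 * h x ^ 2 + d ^ 2
        - 2 * c * (h x * F x) + 2 * d * F x - 2 * c * d * h x := by ring
    simp_rw [e]
    rw [integral_sub (by fun_prop) (by fun_prop), integral_add (by fun_prop) (by fun_prop),
      integral_sub (by fun_prop) (by fun_prop), integral_add (by fun_prop) (by fun_prop),
      integral_add (by fun_prop) (by fun_prop)]
    simp only [integral_const_mul, integral_const, probReal_univ, one_smul]
  set a := ∫ x, F x ∂μ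
  set p := ∫ x, h x * F x ∂μ
  have h0 := key (p - a) (p - a - a)
  have hn : 0 ≤ ∫ x, (F x - (p - a) * h x + (p - a - a)) ^ 2 ∂μ :=
    integral_nonneg fun x => sq_nonneg _
  rw [h0, h1] at hn
  nlinarith [mul_le_mul_of_nonneg_left h2 (sq_nonneg (p - a))]

lemma measurePreserving_projLeft (n m : ℕ) :
    MeasurePreserving (fun (y : Fin (n + m) → ℝ) i => y (Fin.castAdd m i))
      (stdGaussian (n + m)) (stdGaussian n) := by
  refine ⟨by fun_prop, (Measure.pi_eq fun s hs => ?_).symm⟩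
  rw [Measure.map_apply (by fun_prop) (MeasurableSet.univ_pi hs)]
  have : (fun (y : Fin (n + m) → ℝ) i => y (Fin.castAdd m i)) ⁻¹' Set.univ.pi s
      = Set.univ.pi (Fin.append s fun _ => Set.univ) := by
    ext y
    simp only [Set.mem_preimage, Set.mem_pi, Set.mem_univ, true_implies]
    constructor
    · intro h i
      refine Fin.addCases (fun i => ?_) (fun i => ?_) i <;> simp [h]
    · intro h i
      simpa using h (Fin.castAdd m i)
  rw [this, _root_.stdGaussian, Measure.pi_pi, Fin.prod_univ_add]
  simp

lemma memLp_euclNorm (d : ℕ) : MemLp (euclNorm : (Fin d → ℝ) → ℝ) 2 (stdGaussian d) := by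
  rw [memLp_two_iff_integrable_sq continuous_euclNorm.aestronglyMeasurable]
  simp_rw [euclNorm_sq]
  refine integrable_finsetSum _ fun i _ => ?_
  exact integrable_comp_eval (μ := fun _ : Fin d => gaussianReal 0 1) (f := fun x => x ^ 2)
    (memLp_id_gaussianReal 2).integrable_sq

lemma integral_abs_gaussian_pos : 0 < ∫ x, |x| ∂gaussianReal 0 1 := by
  have hi : Integrable (fun x : ℝ => |x|) (gaussianReal 0 1) :=
    ((memLp_id_gaussianReal 1).integrable (by simp)).abs
  rw [integral_pos_iff_support_of_nonneg (fun x => abs_nonneg x) hi]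
  have : Function.support (fun x : ℝ => |x|) = {0}ᶜ := by ext; simp
  have := nullSingletonClass_gaussianReal (μ := 0) (v := 1) one_ne_zero
  rw [‹Function.support _ = _›, measure_compl (measurableSet_singleton _) (by simp)]
  simp

/-- The Euclidean norm of a standard Gaussian vector in `ℝᵐ` has mean of order at least `√m`. -/
lemma sqrt_mul_le_integral_euclNorm_projRight (n m : ℕ) :
    √m * ∫ x, |x| ∂gaussianReal 0 1
      ≤ ∫ y, euclNorm (fun j => y (Fin.natAdd n j)) ∂stdGaussian (n + m) := by
  rcases Nat.eq_zero_or_pos m with rfl | hm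
  · simp only [Nat.cast_zero, Real.sqrt_zero, zero_mul]
    exact integral_nonneg fun y => euclNorm_nonneg _
  have hm' : 0 < √(m : ℝ) := Real.sqrt_pos.2 (by exact_mod_cast hm)
  have hi : Integrable (fun x : ℝ => |x|) (gaussianReal 0 1) :=
    ((memLp_id_gaussianReal 1).integrable (by simp)).abs
  have hij (j : Fin m) : Integrable (fun y : Fin (n + m) → ℝ => |y (Fin.natAdd n j)|)
      (stdGaussian (n + m)) :=
    integrable_comp_eval (μ := fun _ : Fin (n + m) => gaussianReal 0 1) hi
  have hsum : ∫ y, ∑ j : Fin m, |y (Fin.natAdd n j)| ∂stdGaussian (n + m)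
      = m * ∫ x, |x| ∂gaussianReal 0 1 := by
    rw [integral_finsetSum _ fun j _ => hij j]
    have (j : Fin m) : ∫ y, |y (Fin.natAdd n j)| ∂stdGaussian (n + m)
        = ∫ x, |x| ∂gaussianReal 0 1 :=
      integral_comp_eval (μ := fun _ : Fin (n + m) => gaussianReal 0 1) (f := fun x => |x|)
        hi.aestronglyMeasurable
    simp [this]
  have hle (y : Fin (n + m) → ℝ) :
      ∑ j : Fin m, |y (Fin.natAdd n j)| ≤ √m * euclNorm (fun j => y (Fin.natAdd n j)) := by
    rw [euclNorm, ← Real.sqrt_mul (by positivity)]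
    refine Real.le_sqrt_of_sq_le ?_
    simpa using sq_sum_le_card_mul_sum_sq (s := Finset.univ) (f := fun j => |y (Fin.natAdd n j)|)
  have hint : Integrable (fun y => euclNorm (fun j => y (Fin.natAdd n j))) (stdGaussian (n + m)) :=
    ((memLp_euclNorm (n + m)).integrable one_le_two).mono'
      (continuous_euclNorm.comp (by fun_prop)).aestronglyMeasurable
      (ae_of_all _ fun y => by
        rw [Real.norm_of_nonneg (euclNorm_nonneg _)]; exact euclNorm_natAdd_le y)
  have := integral_mono (integrable_finsetSum _ fun j _ => hij j) (hint.const_mul √m) hle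
  rw [hsum, integral_const_mul] at this
  refine le_of_mul_le_mul_left (le_of_eq_of_le ?_ this) hm'
  rw [← mul_assoc, Real.mul_self_sqrt (by positivity)]

section NormBounds

variable {n : ℕ} {N : (Fin n → ℝ) → ℝ}

lemma norm_nonneg_of_subadditive (hadd : ∀ x y, N (x + y) ≤ N x + N y)
    (hsmul : ∀ (r : ℝ) (x), N (r • x) = |r| * N x) (x : Fin n → ℝ) : 0 ≤ N x := by
  have h1 := hadd x ((-1 : ℝ) • x)
  have h2 := hsmul 0 x
  rw [hsmul] at h1
  simp only [zero_smul, abs_zero, zero_mul, neg_smul, one_smul, add_neg_cancel, abs_neg,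
    abs_one, one_mul] at h1 h2
  linarith

lemma norm_le_euclNorm (hsmul : ∀ (r : ℝ) (x), N (r • x) = |r| * N x)
    (hball : ∀ x, euclNorm x ≤ 1 → N x ≤ 1) (x : Fin n → ℝ) : N x ≤ euclNorm x := by
  rcases (euclNorm_nonneg x).eq_or_lt with h | h
  · have hx : x = (0 : ℝ) • x := by rw [zero_smul]; exact euclNorm_eq_zero h.symm
    rw [hx, hsmul]
    simpa using euclNorm_nonneg _
  · have h1 := hball ((euclNorm x)⁻¹ • x) (by
      rw [euclNorm_smul, abs_of_pos (inv_pos.2 h), inv_mul_cancel₀ h.ne'])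
    rwa [hsmul, abs_of_pos (inv_pos.2 h), inv_mul_le_one₀ h] at h1

lemma continuous_of_subadditive (hadd : ∀ x y, N (x + y) ≤ N x + N y)
    (hle : ∀ x, N x ≤ euclNorm x) : Continuous N := by
  rw [continuous_iff_continuousAt]
  intro x
  have h0 : Filter.Tendsto (fun y : Fin n → ℝ => euclNorm (y - x)) (nhds x) (nhds 0) := by
    have : Continuous fun y : Fin n → ℝ => euclNorm (y - x) :=
      continuous_euclNorm.comp (by fun_prop)
    simpa [euclNorm] using this.tendsto x
  refine tendsto_iff_dist_tendsto_zero.2 (squeeze_zero (fun _ => dist_nonneg) (fun y => ?_) h0)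
  have h1 := hadd (y - x) x
  have h2 := hadd (x - y) y
  have h3 : euclNorm (x - y) = euclNorm (y - x) := by
    rw [euclNorm_eq_norm, euclNorm_eq_norm, WithLp.toLp_sub, WithLp.toLp_sub, norm_sub_rev]
  rw [sub_add_cancel] at h1 h2
  have h4 := hle (y - x)
  have h5 := hle (x - y)
  rw [Real.dist_eq, abs_le]
  constructor <;> linarith

lemma bConst_le_one (hle : ∀ x, N x ≤ euclNorm x) : bConst N ≤ 1 := by
  refine Real.sSup_le ?_ zero_le_one
  rintro s ⟨θ, hθ, rfl⟩
  exact (hle θ).trans_eq hθ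

lemma bConst_nonneg (hnn : ∀ x, 0 ≤ N x) : 0 ≤ bConst N := by
  refine Real.sSup_nonneg ?_
  rintro s ⟨θ, -, rfl⟩
  exact hnn θ

lemma bConst_pos (hn : 1 ≤ n) (hnn : ∀ x, 0 ≤ N x) (hle : ∀ x, N x ≤ euclNorm x)
    (hdef : ∀ x, N x = 0 → x = 0) : 0 < bConst N := by
  let θ : Fin n → ℝ := Pi.single ⟨0, hn⟩ 1
  have hθ : euclNorm θ = 1 := by
    rw [euclNorm_eq_norm]
    exact (PiLp.norm_single 2 (fun _ => ℝ) _ _).trans norm_one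
  have hpos : 0 < N θ := (hnn θ).lt_of_ne' fun h => by
    rw [hdef θ h] at hθ
    simp [euclNorm] at hθ
  refine hpos.trans_le (le_csSup ⟨1, ?_⟩ ⟨θ, hθ, rfl⟩)
  rintro s ⟨η, hη, rfl⟩
  exact (hle η).trans_eq hη

lemma integrable_of_le_euclNorm (hnn : ∀ x, 0 ≤ N x) (hc : Continuous N)
    (hle : ∀ x, N x ≤ euclNorm x) : Integrable N (stdGaussian n) :=
  ((memLp_euclNorm n).integrable one_le_two).mono' hc.aestronglyMeasurable
    (ae_of_all _ fun x => by rw [Real.norm_of_nonneg (hnn x)]; exact hle x)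

lemma integral_norm_pos (hn : 1 ≤ n) (hnn : ∀ x, 0 ≤ N x) (hc : Continuous N)
    (hle : ∀ x, N x ≤ euclNorm x) (hdef : ∀ x, N x = 0 → x = 0) :
    0 < ∫ x, N x ∂stdGaussian n := by
  rw [integral_pos_iff_support_of_nonneg hnn (integrable_of_le_euclNorm hnn hc hle)]
  have hsub : ({0}ᶜ : Set (Fin n → ℝ)) ⊆ Function.support N := fun x hx h => hx (hdef x h)
  refine lt_of_lt_of_le ?_ (measure_mono hsub)
  have h0 : stdGaussian n {0} = 0 := by
    have : ({0} : Set (Fin n → ℝ)) = Set.univ.pi fun _ => {0} := by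
      ext x; simp [funext_iff]
    have hg := nullSingletonClass_gaussianReal (μ := 0) (v := 1) one_ne_zero
    rw [this, _root_.stdGaussian, Measure.pi_pi]
    exact Finset.prod_eq_zero (Finset.mem_univ ⟨0, hn⟩) (measure_singleton _)
  rw [measure_compl (measurableSet_singleton _) (by simp), h0]
  simp

end NormBounds

lemma normY_le_euclNorm {n m : ℕ} {N : (Fin n → ℝ) → ℝ} (hle : ∀ x, N x ≤ euclNorm x)
    (y : Fin (n + m) → ℝ) : normY n m N y ≤ euclNorm y :=
  max_le ((hle _).trans (euclNorm_castAdd_le y)) (euclNorm_natAdd_le y)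

lemma normY_nonneg {n m : ℕ} {N : (Fin n → ℝ) → ℝ} (y : Fin (n + m) → ℝ) :
    0 ≤ normY n m N y :=
  (euclNorm_nonneg _).trans (le_max_right _ _)

lemma continuous_normY {n m : ℕ} {N : (Fin n → ℝ) → ℝ} (hc : Continuous N) :
    Continuous (normY n m N) :=
  (hc.comp (by fun_prop)).max (continuous_euclNorm.comp (by fun_prop))

/-- Coordinatewise factors dilating the last `m` coordinates by `t`. -/
def tailScale (n m : ℕ) (t : ℝ) : Fin (n + m) → ℝ := Fin.append (fun _ => 1) (fun _ => t)

lemma tailScale_mem {n m : ℕ} {t : ℝ} (ht : 0 < t) (ht1 : t ≤ 1) (i : Fin (n + m)) :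
    0 < tailScale n m t i ∧ tailScale n m t i ≤ 1 := by
  refine Fin.addCases (fun i => ?_) (fun i => ?_) i <;> simp [tailScale, ht, ht1]

lemma normY_tailScale {n m : ℕ} {N : (Fin n → ℝ) → ℝ} {t : ℝ} (ht : 0 < t)
    (y : Fin (n + m) → ℝ) :
    normY n m N (fun i => tailScale n m t i * y i)
      = max (N fun i => y (Fin.castAdd m i)) (t * euclNorm fun j => y (Fin.natAdd n j)) := by
  have h := euclNorm_smul t fun j => y (Fin.natAdd n j)
  rw [abs_of_pos ht] at h
  rw [← h]
  simp only [normY, tailScale, Fin.append_left, Fin.append_right, one_mul]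
  rfl

lemma mul_sub_le_max_sub_max {t A W : ℝ} (ht : 0 ≤ t) (ht1 : t ≤ 1) (hA : 0 ≤ A)
    (hW : 0 ≤ W) :
    (1 - t) * (W - A) ≤ max A W - max A (t * W) := by
  have htW : t * W ≤ W := mul_le_of_le_one_left hW ht1
  have hA' := mul_nonneg (sub_nonneg.2 ht1) hA
  rcases le_total A (t * W) with h | h
  · rw [max_eq_right h, max_eq_right (h.trans htW)]
    linarith
  · rw [max_eq_left h]
    rcases le_total A W with h' | h'
    · rw [max_eq_right h']
      linarith [mul_nonneg ht (sub_nonneg.2 h')]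
    · rw [max_eq_left h', sub_self]
      exact mul_nonpos_of_nonneg_of_nonpos (sub_nonneg.2 ht1) (sub_nonpos.2 h')

/-- The second moment of the density of the law of `t * Z` for `t² = 1 - η`. -/
lemma integral_prod_scalingDensity_sq_le {n m : ℕ} {t η : ℝ} (ht : 0 < t) (htη : t ^ 2 = 1 - η)
    (hη : 0 ≤ η) (hη1 : η < 1) (hηm : m * η ^ 2 ≤ 3 / 4) :
    ∫ y : Fin (n + m) → ℝ, (∏ i, scalingDensity (tailScale n m t i) (y i)) ^ 2
      ∂stdGaussian (n + m) ≤ 2 := by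
  have ht1 : t ≤ 1 := by nlinarith
  simp_rw [← Finset.prod_pow]
  rw [_root_.stdGaussian, integral_fintype_prod_eq_prod
    (f := fun (i : Fin (n + m)) x => scalingDensity (tailScale n m t i) x ^ 2), Fin.prod_univ_add]
  simp only [tailScale, Fin.append_left, Fin.append_right, scalingDensity_one, one_pow,
    integral_const, probReal_univ, one_smul, Finset.prod_const_one, one_mul,
    integral_scalingDensity_sq ht ht1, Finset.prod_const, Finset.card_univ, Fintype.card_fin]
  have hη2 : 0 < 1 - η ^ 2 := by nlinarith
  have hb : 1 / 4 ≤ (1 - η ^ 2) ^ m := by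
    have := one_add_mul_le_pow (a := -η ^ 2) (by nlinarith) m
    rw [← sub_eq_add_neg] at this
    linarith
  have he : t ^ 2 * (2 - t ^ 2) = 1 - η ^ 2 := by rw [htη]; ring
  have hs : √((1 - η ^ 2) ^ m) = √(1 - η ^ 2) ^ m := by
    refine (Real.sqrt_eq_iff_mul_self_eq (by positivity) (by positivity)).2 ?_
    rw [← mul_pow, Real.mul_self_sqrt hη2.le]
  rw [he, inv_pow, ← hs]
  refine inv_le_of_inv_le₀ two_pos (Real.le_sqrt_of_sq_le ?_)
  linarith

/-- If the mean of `N` is small compared to `√m`, the norm of `Y` has variance bounded below. -/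
theorem le_variance_normY {n m : ℕ} (hm : 1 ≤ m) {N : (Fin n → ℝ) → ℝ} (hc : Continuous N)
    (hnn : ∀ x, 0 ≤ N x) (hle : ∀ x, N x ≤ euclNorm x) {κ : ℝ}
    (hκ : κ = ∫ x, |x| ∂gaussianReal 0 1)
    (hsmall : ∫ x, N x ∂stdGaussian n ≤ κ * √m / 2) :
    3 * κ ^ 2 / 64 ≤ (∫ y, (normY n m N y) ^ 2 ∂stdGaussian (n + m))
      - (∫ y, normY n m N y ∂stdGaussian (n + m)) ^ 2 := by
  have hm1 : (1 : ℝ) ≤ m := by exact_mod_cast hm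
  have hκ0 : 0 < κ := hκ ▸ integral_abs_gaussian_pos
  set η : ℝ := √(3 / (4 * m)) with hηdef
  have hη0 : 0 ≤ η := Real.sqrt_nonneg _
  have hηsq : m * η ^ 2 = 3 / 4 := by
    rw [hηdef, Real.sq_sqrt (by positivity)]
    field_simp
  have hη1 : η < 1 := by nlinarith
  set t : ℝ := √(1 - η) with htdef
  have ht : 0 < t := Real.sqrt_pos.2 (by linarith)
  have htη : t ^ 2 = 1 - η := Real.sq_sqrt (by linarith)
  have htle : t ≤ 1 - η / 2 := by nlinarith
  have ht1 : t ≤ 1 := by linarith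
  set h : (Fin (n + m) → ℝ) → ℝ := fun y => ∏ i, scalingDensity (tailScale n m t i) (y i) with hh
  have hs := fun i => (tailScale_mem (n := n) (m := m) ht ht1 i).1
  have hs1 := fun i => (tailScale_mem (n := n) (m := m) ht ht1 i).2
  have hcY := continuous_normY (m := m) hc
  have hFL : MemLp (normY n m N) 2 (stdGaussian (n + m)) :=
    (memLp_euclNorm (n + m)).mono hcY.aestronglyMeasurable (ae_of_all _ fun y => by
      rw [Real.norm_of_nonneg (normY_nonneg y), Real.norm_of_nonneg (euclNorm_nonneg y)]
      exact normY_le_euclNorm hle y)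
  have hhc : Continuous h :=
    continuous_finsetProd _ fun i _ => (continuous_scalingDensity _).comp (continuous_apply i)
  have hhL : MemLp h 2 (stdGaussian (n + m)) := by
    refine .of_bound hhc.aestronglyMeasurable (∏ i, (tailScale n m t i)⁻¹) (ae_of_all _ fun y => ?_)
    rw [Real.norm_of_nonneg (Finset.prod_nonneg fun i _ => scalingDensity_nonneg (hs i) _)]
    exact Finset.prod_le_prod (fun i _ => scalingDensity_nonneg (hs i) _)
      fun i _ => scalingDensity_le (hs i) (hs1 i) _
  have hh1 : ∫ y, h y ∂stdGaussian (n + m) = 1 := by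
    have := integral_comp_scaling (tailScale n m t) hs hs1 (F := fun _ => 1) continuous_const
    simpa [hh] using this.symm
  have hh2 : ∫ y, h y ^ 2 ∂stdGaussian (n + m) ≤ 2 :=
    integral_prod_scalingDensity_sq_le ht htη hη0 hη1 hηsq.le
  refine le_trans ?_ (sq_integral_sub_le_variance hFL hhL hh1 hh2)
  have hcS : Continuous fun y : Fin (n + m) → ℝ =>
      normY n m N (fun i => tailScale n m t i * y i) := hcY.comp (by fun_prop)
  have hFint := hFL.integrable one_le_two
  have hWint : Integrable (fun y => euclNorm (fun j => y (Fin.natAdd n j)))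
      (stdGaussian (n + m)) :=
    hFint.mono' (continuous_euclNorm.comp (by fun_prop)).aestronglyMeasurable
      (ae_of_all _ fun y => by
        rw [Real.norm_of_nonneg (euclNorm_nonneg _)]; exact le_max_right _ _)
  have hAint : Integrable (fun y : Fin (n + m) → ℝ => N fun i => y (Fin.castAdd m i))
      (stdGaussian (n + m)) :=
    hFint.mono' (hc.comp (by fun_prop)).aestronglyMeasurable
      (ae_of_all _ fun y => by
        rw [Real.norm_of_nonneg (hnn _)]; exact le_max_left _ _)
  have hFS : Integrable (fun y : Fin (n + m) → ℝ =>
      normY n m N (fun i => tailScale n m t i * y i)) (stdGaussian (n + m)) :=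
    hFint.mono' hcS.aestronglyMeasurable (ae_of_all _ fun y => by
      rw [Real.norm_of_nonneg (normY_nonneg _), normY_tailScale ht]
      exact max_le_max le_rfl (mul_le_of_le_one_left (euclNorm_nonneg _) ht1))
  have hA : ∫ y : Fin (n + m) → ℝ, N (fun i => y (Fin.castAdd m i)) ∂stdGaussian (n + m)
      = ∫ x, N x ∂stdGaussian n := by
    rw [← (measurePreserving_projLeft n m).map_eq,
      integral_map (measurePreserving_projLeft n m).measurable.aemeasurable hc.aestronglyMeasurable]
  have hW := sqrt_mul_le_integral_euclNorm_projRight n m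
  rw [← hκ] at hW
  have hmono := integral_mono ((hWint.sub hAint).const_mul (1 - t)) (hFint.sub hFS) fun y => by
    simp only [Pi.sub_apply, normY_tailScale ht]
    exact mul_sub_le_max_sub_max ht.le ht1 (hnn _) (euclNorm_nonneg _)
  rw [integral_const_mul, integral_sub' hWint hAint, integral_sub' hFint hFS, hA,
    integral_comp_scaling _ hs hs1 hcY] at hmono
  have hηm : η * √m = √3 / 2 := by
    rw [hηdef, ← Real.sqrt_mul (by positivity), eq_comm,
      show (2 : ℝ) = √(2 ^ 2) by rw [Real.sqrt_sq two_pos.le], ← Real.sqrt_div (by norm_num)]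
    congr 1
    field_simp
    norm_num
  have hlow : √3 * κ / 8 ≤ ∫ y, normY n m N y ∂stdGaussian (n + m)
      - ∫ y, h y * normY n m N y ∂stdGaussian (n + m) := by
    refine le_trans ?_ hmono
    calc √3 * κ / 8 = (η / 2) * (κ * √m / 2) := by linear_combination (-κ / 4) * hηm
      _ ≤ _ := mul_le_mul (by linarith) (by linarith) (by positivity) (by linarith)
  calc 3 * κ ^ 2 / 64 = (√3 * κ / 8) ^ 2 := by
        rw [div_pow, mul_pow, Real.sq_sqrt (by norm_num)]; norm_num
    _ ≤ _ := pow_le_pow_left₀ (by positivity) hlow 2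

/-- If `B_X` is in John's position then (i) `B_Y` is in John's position, and (ii) there
are absolute constants `C, c > 0` such that `m ≥ C k(X)` implies
`Var(‖G‖_Y) ≥ c b(Y)²` for `G ~ N(0, I_{n+m})`. -/
theorem statement16 :
    ∃ C > (0 : ℝ), ∃ c > (0 : ℝ), ∀ n : ℕ, 1 ≤ n → ∀ m : ℕ,
      ∀ N : (Fin n → ℝ) → ℝ,
        (∀ x y, N (x + y) ≤ N x + N y) →
        (∀ (r : ℝ) (x), N (r • x) = |r| * N x) →
        (∀ x, N x = 0 → x = 0) →
        JohnPosition N →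
        JohnPosition (normY n m N) ∧
        (C * critDim n N ≤ (m : ℝ) →
          c * (bConst (normY n m N)) ^ 2 ≤
            (∫ y, (normY n m N y) ^ 2 ∂stdGaussian (n + m))
              - (∫ y, normY n m N y ∂stdGaussian (n + m)) ^ 2) := by
  have hκ0 := integral_abs_gaussian_pos
  set κ : ℝ := ∫ x, |x| ∂gaussianReal 0 1 with hκ
  refine ⟨4 / κ ^ 2, by positivity, 3 * κ ^ 2 / 64, by positivity, ?_⟩
  intro n hn m N hadd hsmul hdef hJ
  have hnn := norm_nonneg_of_subadditive hadd hsmul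
  have hle := norm_le_euclNorm hsmul hJ.1
  have hc := continuous_of_subadditive hadd hle
  refine ⟨johnPosition_normY hle hJ, fun hk => ?_⟩
  have ha := integral_norm_pos hn hnn hc hle hdef
  have hb := bConst_pos hn hnn hle hdef
  have hb1 := bConst_le_one hle
  have hbY := bConst_le_one (normY_le_euclNorm (m := m) hle)
  have hbY0 := bConst_nonneg (normY_nonneg (n := n) (m := m) (N := N))
  rw [critDim] at hk
  set a := ∫ x, N x ∂stdGaussian n
  have hab : a ≤ a / bConst N := le_div_self ha.le hb hb1
  have hk' : 4 / κ ^ 2 * a ^ 2 ≤ m :=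
    le_trans (by gcongr) hk
  have hm : 1 ≤ m := by
    have : (0 : ℝ) < m := lt_of_lt_of_le (by positivity) hk'
    exact_mod_cast this
  have hsmall : a ≤ κ * √m / 2 := by
    have h1 : (2 * a / κ) ^ 2 ≤ m := by
      refine le_of_eq_of_le ?_ hk'
      ring
    have h2 := Real.le_sqrt_of_sq_le h1
    rw [div_le_iff₀ hκ0] at h2
    linarith
  refine le_trans ?_ (le_variance_normY hm hc hnn hle hκ hsmall)
  exact mul_le_of_le_one_right (by positivity) (pow_le_one₀ hbY0 hbY)
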